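/- arXiv:1802.00783 — 2 statements merged into one kernel-verified Lean document; each statement's English description precedes it below -/
import Mathlib

section
/- The average purity of the k-body reductions is determined by the weight distribution: for every Hermitian n-qubit operator ρ and every 0 ≤ k ≤ n, ∑_{S ⊆ Fin n, |S| = k} tr(ρ_S²) = 2^{−k} · ∑_{j=0}^{k} C(n−j, n−k) · A_j(ρ), where the sum on the left runs over all k-element subsets S of Fin n. -/
open Finset

/-- The single-qubit Pauli matrices `σ₀ = I`, `σ₁ = X`, `σ₂ = Y`, `σ₃ = Z`. -/
noncomputable def pauli : Fin 4 → Matrix (Fin 2) (Fin 2) ℂ :=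
  ![!![1, 0; 0, 1], !![0, 1; 1, 0], !![0, -Complex.I; Complex.I, 0], !![1, 0; 0, -1]]

/-- The `n`-qubit Pauli operator `P_f` with entries `P_f(x,y) = ∏ i, σ_{f i}(x i, y i)`. -/
noncomputable def pauliOp {ι : Type} [Fintype ι] (f : ι → Fin 4) :
    Matrix (ι → Fin 2) (ι → Fin 2) ℂ :=
  Matrix.of fun x y => ∏ i, pauli (f i) (x i) (y i)

/-- The weight of a Pauli label: the number of qubits on which it acts non-trivially. -/
def pauliWt {ι : Type} [Fintype ι] [DecidableEq ι] (f : ι → Fin 4) : ℕ :=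
  (Finset.univ.filter fun i => f i ≠ 0).card

/-- The weight distribution `A_j(ρ) = ∑_{f : wt(f) = j} tr(P_f ρ) · tr(P_f ρ)`. -/
noncomputable def weightA {ι : Type} [Fintype ι] [DecidableEq ι]
    (ρ : Matrix (ι → Fin 2) (ι → Fin 2) ℂ) (j : ℕ) : ℂ :=
  ∑ f ∈ Finset.univ.filter (fun f : ι → Fin 4 => pauliWt f = j),
    (pauliOp f * ρ).trace * (pauliOp f * ρ).trace

/-- Combine an assignment on `S` with an assignment on its complement. -/
def combineOn {n : ℕ} (S : Finset (Fin n)) (a : {v : Fin n // v ∈ S} → Fin 2)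
    (b : {v : Fin n // v ∉ S} → Fin 2) : Fin n → Fin 2 :=
  fun v => if h : v ∈ S then a ⟨v, h⟩ else b ⟨v, h⟩

/-- The reduction `ρ_S` of an `n`-qubit operator onto the subset `S`,
obtained by tracing out the qubits outside `S`. -/
noncomputable def reduceTo {n : ℕ} (ρ : Matrix (Fin n → Fin 2) (Fin n → Fin 2) ℂ)
    (S : Finset (Fin n)) :
    Matrix ({v : Fin n // v ∈ S} → Fin 2) ({v : Fin n // v ∈ S} → Fin 2) ℂ :=
  Matrix.of fun a a' => ∑ b : {v : Fin n // v ∉ S} → Fin 2,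
    ρ (combineOn S a b) (combineOn S a' b)

/-- Completeness of the single-qubit Pauli basis: `∑ c, σ_c ⊗ σ_c` is twice the swap. -/
lemma sum_pauli_mul_pauli (a b a' b' : Fin 2) :
    ∑ c, pauli c a b * pauli c a' b' = if a = b' ∧ b = a' then 2 else 0 := by
  fin_cases a <;> fin_cases b <;> fin_cases a' <;> fin_cases b' <;>
    simp [pauli, Fin.sum_univ_four] <;> norm_num

/-- Completeness of the Pauli basis on several qubits. -/
lemma sum_pauliOp_mul_pauliOp {ι : Type} [Fintype ι] [DecidableEq ι] (x y x' y' : ι → Fin 2) :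
    ∑ f, pauliOp f x y * pauliOp f x' y'
      = if x = y' ∧ y = x' then (2 : ℂ) ^ Fintype.card ι else 0 := by
  simp only [pauliOp, Matrix.of_apply, ← Finset.prod_mul_distrib]
  rw [← Fintype.prod_sum (fun i c => pauli c (x i) (y i) * pauli c (x' i) (y' i))]
  simp only [sum_pauli_mul_pauli]
  split_ifs with h
  · obtain ⟨rfl, rfl⟩ := h
    simp
  · have : ∃ i, ¬ (x i = y' i ∧ y i = x' i) := by
      by_contra! hc
      exact h ⟨funext fun i => (hc i).1, funext fun i => (hc i).2⟩
    obtain ⟨i, hi⟩ := this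
    exact Finset.prod_eq_zero (Finset.mem_univ i) (if_neg hi)

/-- Parseval's identity for the Pauli basis. -/
lemma sum_trace_pauliOp_mul_sq {ι : Type} [Fintype ι] [DecidableEq ι]
    (M : Matrix (ι → Fin 2) (ι → Fin 2) ℂ) :
    ∑ f, (pauliOp f * M).trace * (pauliOp f * M).trace
      = (2 : ℂ) ^ Fintype.card ι * (M * M).trace := by
  have expand (f : ι → Fin 4) : (pauliOp f * M).trace * (pauliOp f * M).trace
      = ∑ p : (ι → Fin 2) × (ι → Fin 2), ∑ q : (ι → Fin 2) × (ι → Fin 2),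
          (pauliOp f p.1 p.2 * pauliOp f q.1 q.2) * (M p.2 p.1 * M q.2 q.1) := by
    simp only [Matrix.trace, Matrix.diag, Matrix.mul_apply]
    rw [← Fintype.sum_prod_type' (fun x y => pauliOp f x y * M y x), Finset.sum_mul_sum]
    exact Finset.sum_congr rfl fun p _ => Finset.sum_congr rfl fun q _ => by ring
  simp only [expand]
  rw [Finset.sum_comm]
  simp only [Finset.sum_comm (s := (Finset.univ : Finset (ι → Fin 4))), ← Finset.sum_mul,
    sum_pauliOp_mul_pauliOp]
  simp only [Matrix.trace, Matrix.diag, Matrix.mul_apply, Finset.mul_sum]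
  rw [← Fintype.sum_prod_type' (fun x y => (2 : ℂ) ^ Fintype.card ι * (M x y * M y x))]
  refine Finset.sum_congr rfl fun p _ => ?_
  rw [Finset.sum_eq_single (p.2, p.1)]
  · simp [mul_comm]
  · intro q _ hq
    rw [if_neg, zero_mul]
    rintro ⟨h₁, h₂⟩
    exact hq (Prod.ext h₂.symm h₁.symm)
  · simp

/-- Extension of a Pauli label on `S` by the identity outside `S`. -/
def extendLabel {n : ℕ} (S : Finset (Fin n)) (g : {v : Fin n // v ∈ S} → Fin 4) :
    Fin n → Fin 4 :=
  fun v => if h : v ∈ S then g ⟨v, h⟩ else 0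

lemma pauli_zero_apply (a b : Fin 2) : pauli 0 a b = if a = b then 1 else 0 := by
  fin_cases a <;> fin_cases b <;> simp [pauli]

lemma pauliOp_extendLabel_combineOn {n : ℕ} (S : Finset (Fin n))
    (g : {v : Fin n // v ∈ S} → Fin 4) (a a' : {v : Fin n // v ∈ S} → Fin 2)
    (b b' : {v : Fin n // v ∉ S} → Fin 2) :
    pauliOp (extendLabel S g) (combineOn S a b) (combineOn S a' b')
      = if b = b' then pauliOp g a a' else 0 := by
  simp only [pauliOp, Matrix.of_apply]
  rw [← Fintype.prod_subtype_mul_prod_subtype (fun v => v ∈ S)]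
  have inside (v : {v : Fin n // v ∈ S}) :
      pauli (extendLabel S g v) (combineOn S a b v) (combineOn S a' b' v)
        = pauli (g v) (a v) (a' v) := by
    simp [extendLabel, combineOn, v.2]
  have outside (v : {v : Fin n // v ∉ S}) :
      pauli (extendLabel S g v) (combineOn S a b v) (combineOn S a' b' v)
        = if b v = b' v then 1 else 0 := by
    simp [extendLabel, combineOn, v.2, pauli_zero_apply]
  simp only [inside, outside]
  split_ifs with h
  · subst h
    simp only [if_true, Finset.prod_const_one, mul_one]
    exact Finset.prod_congr (by ext; simp) fun _ _ => rfl
  · obtain ⟨v, hv⟩ := Function.ne_iff.mp h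
    rw [Finset.prod_eq_zero (Finset.mem_univ v) (if_neg hv), mul_zero]

lemma sum_eq_sum_combineOn {n : ℕ} (S : Finset (Fin n)) (F : (Fin n → Fin 2) → ℂ) :
    ∑ x, F x = ∑ a, ∑ b, F (combineOn S a b) := by
  rw [← Fintype.sum_prod_type' (fun a b => F (combineOn S a b))]
  exact ((Equiv.piEquivPiSubtypeProd (fun v => v ∈ S) fun _ => Fin 2).symm.sum_comp F).symm

/-- Pauli coefficients of a reduction are Pauli coefficients of the full operator. -/
lemma trace_pauliOp_mul_reduceTo {n : ℕ} (ρ : Matrix (Fin n → Fin 2) (Fin n → Fin 2) ℂ)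
    (S : Finset (Fin n)) (g : {v : Fin n // v ∈ S} → Fin 4) :
    (pauliOp g * reduceTo ρ S).trace = (pauliOp (extendLabel S g) * ρ).trace := by
  simp only [Matrix.trace, Matrix.diag, Matrix.mul_apply]
  simp only [sum_eq_sum_combineOn S, pauliOp_extendLabel_combineOn, ite_mul, zero_mul,
    Finset.sum_ite_eq, Finset.mem_univ, if_true]
  simp only [reduceTo, Matrix.of_apply, Finset.mul_sum]
  exact Finset.sum_congr rfl fun a _ => Finset.sum_comm

lemma sum_extendLabel {n : ℕ} (S : Finset (Fin n)) (F : (Fin n → Fin 4) → ℂ) :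
    ∑ g, F (extendLabel S g)
      = ∑ f : Fin n → Fin 4 with (Finset.univ.filter fun i => f i ≠ 0) ⊆ S, F f := by
  refine Finset.sum_nbij' (extendLabel S) (fun f v => f v) ?_ ?_ ?_ ?_ ?_
  · intro g _
    simp only [Finset.mem_filter, Finset.mem_univ, true_and]
    intro v hv
    by_contra h
    simp [extendLabel, h] at hv
  · simp
  · intro g _
    ext v
    simp [extendLabel]
  · intro f hf
    simp only [Finset.mem_filter, Finset.mem_univ, true_and] at hf
    funext v
    by_cases h : v ∈ S
    · simp [extendLabel, h]
    · have : f v = 0 := by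
        by_contra h0
        exact h (hf (by simpa using h0))
      simp [extendLabel, h, this]
  · simp

/-- The number of `k`-element sets containing a given set. -/
lemma card_powersetCard_filter_superset {n : ℕ} (T : Finset (Fin n)) {k : ℕ} (hk : k ≤ n) :
    ((Finset.powersetCard k (Finset.univ : Finset (Fin n))).filter fun S => T ⊆ S).card
      = (n - T.card).choose (n - k) := by
  have card_compl : Tᶜ.card = n - T.card := by simp [Finset.card_compl]
  rw [← card_compl, ← Finset.card_powersetCard]
  refine Finset.card_nbij' compl compl ?_ ?_ ?_ ?_
  · intro S hS
    simp only [Finset.coe_filter, Finset.mem_powersetCard, Set.mem_ofPred_eq] at hS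
    simp [Finset.mem_powersetCard, Finset.card_compl, hS.1.2, hS.2]
  · intro S hS
    simp only [Finset.mem_coe, Finset.mem_powersetCard] at hS
    simp only [Finset.coe_filter, Finset.mem_powersetCard, Set.mem_ofPred_eq,
      Finset.subset_univ, true_and, Finset.card_compl, Fintype.card_fin, hS.2]
    exact ⟨by omega, Finset.subset_compl_comm.mp hS.1⟩
  · simp [Set.LeftInvOn]
  · simp [Set.LeftInvOn]

/-- The purity of a reduction in terms of the Pauli coefficients supported on `S`. -/
lemma trace_reduceTo_mul_self {n : ℕ} (ρ : Matrix (Fin n → Fin 2) (Fin n → Fin 2) ℂ)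
    (S : Finset (Fin n)) :
    (reduceTo ρ S * reduceTo ρ S).trace
      = ((2 : ℂ) ^ S.card)⁻¹ * ∑ f : Fin n → Fin 4 with (Finset.univ.filter fun i => f i ≠ 0) ⊆ S,
          (pauliOp f * ρ).trace * (pauliOp f * ρ).trace := by
  have parseval := sum_trace_pauliOp_mul_sq (reduceTo ρ S)
  simp only [trace_pauliOp_mul_reduceTo, Fintype.card_coe] at parseval
  rw [sum_extendLabel S fun f => (pauliOp f * ρ).trace * (pauliOp f * ρ).trace] at parseval
  rw [parseval, inv_mul_cancel_left₀ (pow_ne_zero _ two_ne_zero)]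

/-- The average purity of the `k`-body reductions is determined by the weight
distribution: `∑_{|S|=k} tr(ρ_S²) = 2^{-k} ∑_{j=0}^{k} C(n-j, n-k) A_j(ρ)`. -/
theorem average_purity_weightA {n : ℕ} (ρ : Matrix (Fin n → Fin 2) (Fin n → Fin 2) ℂ)
    (hρ : ρ.IsHermitian) (k : ℕ) (hk : k ≤ n) :
    ∑ S ∈ Finset.powersetCard k (Finset.univ : Finset (Fin n)),
        (reduceTo ρ S * reduceTo ρ S).trace
      = ((2 : ℂ) ^ k)⁻¹ *
          ∑ j ∈ Finset.range (k + 1), ((n - j).choose (n - k) : ℂ) * weightA ρ j := by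
  have purity : ∀ S ∈ Finset.powersetCard k (Finset.univ : Finset (Fin n)),
      (reduceTo ρ S * reduceTo ρ S).trace
        = ((2 : ℂ) ^ k)⁻¹ * ∑ f : Fin n → Fin 4 with (Finset.univ.filter fun i => f i ≠ 0) ⊆ S,
            (pauliOp f * ρ).trace * (pauliOp f * ρ).trace := fun S hS => by
    rw [trace_reduceTo_mul_self, (Finset.mem_powersetCard.mp hS).2]
  rw [Finset.sum_congr rfl purity, ← Finset.mul_sum]
  congr 1
  simp only [weightA, Finset.mul_sum, Finset.sum_filter]
  rw [Finset.sum_comm, Finset.sum_comm (s := Finset.range (k + 1))]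
  refine Finset.sum_congr rfl fun f _ => ?_
  rw [← Finset.sum_filter, Finset.sum_const, card_powersetCard_filter_superset _ hk,
    nsmul_eq_mul]
  change ((n - pauliWt f).choose (n - k) : ℂ) * _ = _
  simp only [mul_ite, mul_zero]
  rw [Finset.sum_ite_eq]
  split_ifs with h
  · rfl
  · have wt_le : pauliWt f ≤ n := (Finset.card_le_univ _).trans_eq (Fintype.card_fin n)
    rw [Finset.mem_range] at h
    rw [Nat.choose_eq_zero_of_lt (by omega), Nat.cast_zero, zero_mul]
end

section
/- The overlap of a state with its universal state inversion is the alternating sum of the weight distribution: for every Hermitian n-qubit operator ρ, tr(ρ · ρ̃) = 2^{−n} · ∑_{j=0}^{n} (−1)^j A_j(ρ), where ρ̃ = Y^{⊗n} ρ^T Y^{⊗n} is the spin-flipped (universally inverted) state. -/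
open Finset

/-- The antisymmetrizer on two qubits, expanded in Pauli matrices, factors through `Y`. -/
lemma sum_signed_pauli_mul_pauli (x y z w : Fin 2) :
    ∑ a : Fin 4, (if a ≠ 0 then (-1 : ℂ) else 1) * (pauli a x y * pauli a z w)
      = 2 * (pauli 2 x z * pauli 2 w y) := by
  fin_cases x <;> fin_cases y <;> fin_cases z <;> fin_cases w <;>
    simp [pauli, Fin.sum_univ_four] <;> norm_num

lemma neg_one_pow_pauliWt {ι : Type} [Fintype ι] [DecidableEq ι] (f : ι → Fin 4) :
    (-1 : ℂ) ^ pauliWt f = ∏ i, if f i ≠ 0 then (-1 : ℂ) else 1 := by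
  rw [pauliWt, Finset.prod_ite, Finset.prod_const, Finset.prod_const_one, mul_one]

lemma pauliWt_le_card {ι : Type} [Fintype ι] [DecidableEq ι] (f : ι → Fin 4) :
    pauliWt f ≤ Fintype.card ι :=
  Finset.card_le_univ _

/-- The `n`-qubit version of `sum_signed_pauli_mul_pauli`. -/
lemma sum_signed_pauliOp_mul_pauliOp {ι : Type} [Fintype ι] [DecidableEq ι]
    (x y z w : ι → Fin 2) :
    ∑ f : ι → Fin 4, (-1 : ℂ) ^ pauliWt f * (pauliOp f x y * pauliOp f z w)
      = 2 ^ Fintype.card ι *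
        (pauliOp (fun _ => (2 : Fin 4)) x z * pauliOp (fun _ => (2 : Fin 4)) w y) := by
  simp only [neg_one_pow_pauliWt, pauliOp, Matrix.of_apply, ← Finset.prod_mul_distrib]
  rw [← Fintype.prod_sum fun i a =>
    (if a ≠ 0 then (-1 : ℂ) else 1) * (pauli a (x i) (y i) * pauli a (z i) (w i))]
  simp only [sum_signed_pauli_mul_pauli, Finset.prod_mul_distrib, Finset.prod_const,
    Finset.card_univ]

lemma sum_neg_one_pow_mul_weightA {ι : Type} [Fintype ι] [DecidableEq ι]
    (ρ : Matrix (ι → Fin 2) (ι → Fin 2) ℂ) :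
    ∑ j ∈ Finset.range (Fintype.card ι + 1), (-1 : ℂ) ^ j * weightA ρ j
      = ∑ f : ι → Fin 4,
        (-1 : ℂ) ^ pauliWt f * ((pauliOp f * ρ).trace * (pauliOp f * ρ).trace) := by
  rw [← Finset.sum_fiberwise_of_maps_to (g := pauliWt)
    fun f _ => Finset.mem_range.2 (Nat.lt_succ_of_le (pauliWt_le_card f))]
  refine Finset.sum_congr rfl fun j _ => ?_
  rw [weightA, Finset.mul_sum]
  refine Finset.sum_congr rfl fun f hf => ?_
  rw [(Finset.mem_filter.1 hf).2]

lemma sum_neg_one_pow_mul_trace_mul_trace {ι : Type} [Fintype ι] [DecidableEq ι]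
    (ρ : Matrix (ι → Fin 2) (ι → Fin 2) ℂ) :
    ∑ f : ι → Fin 4, (-1 : ℂ) ^ pauliWt f * ((pauliOp f * ρ).trace * (pauliOp f * ρ).trace)
      = 2 ^ Fintype.card ι * (ρ * (pauliOp (fun _ => (2 : Fin 4)) * ρ.transpose *
        pauliOp (fun _ => (2 : Fin 4)))).trace := by
  calc
    _ = ∑ f : ι → Fin 4, ∑ p : ((ι → Fin 2) × (ι → Fin 2)) × ((ι → Fin 2) × (ι → Fin 2)),
          (-1 : ℂ) ^ pauliWt f * (pauliOp f p.1.1 p.1.2 * pauliOp f p.2.1 p.2.2) *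
            (ρ p.1.2 p.1.1 * ρ p.2.2 p.2.1) := by
      refine Finset.sum_congr rfl fun f _ => ?_
      have h : (pauliOp f * ρ).trace
          = ∑ p : (ι → Fin 2) × (ι → Fin 2), pauliOp f p.1 p.2 * ρ p.2 p.1 := by
        simp only [Matrix.trace, Matrix.diag_apply, Matrix.mul_apply, Fintype.sum_prod_type]
      rw [h, Fintype.sum_mul_sum, ← Fintype.sum_prod_type', Finset.mul_sum]
      exact Finset.sum_congr rfl fun p _ => by ring
    _ = ∑ p : ((ι → Fin 2) × (ι → Fin 2)) × ((ι → Fin 2) × (ι → Fin 2)),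
          2 ^ Fintype.card ι * (pauliOp (fun _ => (2 : Fin 4)) p.1.1 p.2.1 *
            pauliOp (fun _ => (2 : Fin 4)) p.2.2 p.1.2) * (ρ p.1.2 p.1.1 * ρ p.2.2 p.2.1) := by
      rw [Finset.sum_comm]
      simp only [← Finset.sum_mul, sum_signed_pauliOp_mul_pauliOp]
    _ = _ := by
      rw [← Matrix.mul_assoc, ← Matrix.mul_assoc]
      simp only [Matrix.trace, Matrix.diag_apply, Matrix.mul_apply, Matrix.transpose_apply,
        Fintype.sum_prod_type, Finset.sum_mul, Finset.mul_sum]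
      rw [Finset.sum_comm]
      refine Finset.sum_congr rfl fun y _ => ?_
      rw [Finset.sum_comm]
      conv_rhs => rw [Finset.sum_comm]
      refine Finset.sum_congr rfl fun z _ => ?_
      rw [Finset.sum_comm]
      exact Finset.sum_congr rfl fun w _ => Finset.sum_congr rfl fun x _ => by ring

/-- The overlap of a Hermitian `n`-qubit operator with its universal state
inversion `ρ̃ = Y^{⊗n} ρ^T Y^{⊗n}` is the alternating sum of the weight
distribution: `tr(ρ ρ̃) = 2^{-n} ∑_{j=0}^{n} (-1)^j A_j(ρ)`. -/
theorem state_inversion_overlap {n : ℕ} (ρ : Matrix (Fin n → Fin 2) (Fin n → Fin 2) ℂ)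
    (hρ : ρ.IsHermitian) :
    (ρ * (pauliOp (fun _ : Fin n => (2 : Fin 4)) * ρ.transpose *
        pauliOp (fun _ : Fin n => (2 : Fin 4)))).trace
      = ((2 : ℂ) ^ n)⁻¹ * ∑ j ∈ Finset.range (n + 1), (-1 : ℂ) ^ j * weightA ρ j := by
  have h := sum_neg_one_pow_mul_weightA ρ
  rw [sum_neg_one_pow_mul_trace_mul_trace, Fintype.card_fin] at h
  rw [h, inv_mul_cancel_left₀ (pow_ne_zero n two_ne_zero)]
end
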